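/- Let q and f be real numbers and n a natural number. Then C_q(n) · C_{(2−f)/2}(n) = C_{q − (q − 1/2)·f}(n). (That is, the Rappor randomizer with p = 1 − q, composing the Instantaneous Randomized Response with parameter q after the Permanent Randomized Response with parameter f, is an iterated bisymmetric randomizer with parameter q − (q − 1/2)f.) -/

import Mathlib

/-- `Cmat a b n` is the `2^n × 2^n` real matrix indexed by bit strings `x, y ∈ {0,1}^n`
whose `(x, y)` entry is `a ^ (n - d) * b ^ d`, where `d` is the Hamming distance
between `x` and `y`. -/
def Cmat (a b : ℝ) (n : ℕ) : Matrix (Fin n → Fin 2) (Fin n → Fin 2) ℝ :=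
  Matrix.of fun x y => a ^ (n - hammingDist x y) * b ^ hammingDist x y

/-- `CmatB a n` abbreviates `Cmat a (1 - a) n`. -/
def CmatB (a : ℝ) (n : ℕ) : Matrix (Fin n → Fin 2) (Fin n → Fin 2) ℝ :=
  Cmat a (1 - a) n

theorem Cmat_apply_eq_prod (a b : ℝ) (n : ℕ) (x y : Fin n → Fin 2) :
    Cmat a b n x y = ∏ i, if x i = y i then a else b := by
  have hcard := Finset.card_filter_add_card_filter_not
    (s := (Finset.univ : Finset (Fin n))) (fun i => x i = y i)
  rw [Finset.card_univ, Fintype.card_fin] at hcard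
  rw [Finset.prod_ite, Finset.prod_const, Finset.prod_const]
  change a ^ (n - hammingDist x y) * b ^ hammingDist x y = _
  unfold hammingDist
  congr 2
  exact Nat.sub_eq_of_eq_add hcard.symm

theorem Cmat_mul (a b c d : ℝ) (n : ℕ) :
    Cmat a b n * Cmat c d n = Cmat (a * c + b * d) (a * d + b * c) n := by
  ext x z
  simp only [Matrix.mul_apply, Cmat_apply_eq_prod, ← Finset.prod_mul_distrib]
  rw [← Fintype.piFinset_univ, ← Finset.prod_univ_sum (fun _ => Finset.univ)
    (fun i j => (if x i = j then a else b) * (if j = z i then c else d))]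
  refine Finset.prod_congr rfl fun i _ => ?_
  rw [Fin.sum_univ_two]
  generalize x i = u
  generalize z i = v
  fin_cases u <;> fin_cases v <;> simp <;> ring

theorem rappor_composition (q f : ℝ) (n : ℕ) :
    CmatB q n * CmatB ((2 - f) / 2) n = CmatB (q - (q - 1 / 2) * f) n := by
  unfold CmatB
  rw [Cmat_mul]
  congr 1 <;> ring
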